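/- Let R ∈ SO(3) and let M be a 3×3 real symmetric positive-definite matrix with Tr(M) = 3. Let λ̲ > 0 denote the minimum eigenvalue of the matrix M̆ = Tr(M)·I₃ − M. Then 1 + Tr(R) > 0 implies the inequality ‖RM‖_I ≤ (2/λ̲) · ‖vex(P_a(RM))‖² / (1 + Tr(R)), where ‖RM‖_I = (1/4)·Tr((I₃ − R)M). (Note that Tr(R·M·M⁻¹) = Tr(R).) -/

import Mathlib

open Matrix

noncomputable section

/-- The special orthogonal group SO(3): real 3×3 matrices with
`R * Rᵀ = Rᵀ * R = I₃` and `det R = 1`. -/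
def SO3 (R : Matrix (Fin 3) (Fin 3) ℝ) : Prop :=
  R * Rᵀ = 1 ∧ Rᵀ * R = 1 ∧ R.det = 1

/-- The skew-symmetric matrix `[a]ₓ` associated to `a ∈ ℝ³`, satisfying
`[a]ₓ b = a × b`. -/
def skew (a : Fin 3 → ℝ) : Matrix (Fin 3) (Fin 3) ℝ :=
  !![0, -a 2, a 1; a 2, 0, -a 0; -a 1, a 0, 0]

/-- Anti-symmetric projection `P_a(X) = (X - Xᵀ)/2`. -/
def Pa (X : Matrix (Fin 3) (Fin 3) ℝ) : Matrix (Fin 3) (Fin 3) ℝ :=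
  (1 / 2 : ℝ) • (X - Xᵀ)

/-- The `vex` map, inverse of `skew` on skew-symmetric matrices. -/
def vex (X : Matrix (Fin 3) (Fin 3) ℝ) : Fin 3 → ℝ :=
  ![X 2 1, X 0 2, X 1 0]

/-- Normalized Euclidean distance `‖A‖_I = (1/4)·Tr(I₃ − A)`. -/
def normI (A : Matrix (Fin 3) (Fin 3) ℝ) : ℝ :=
  (1 / 4 : ℝ) * Matrix.trace (1 - A)

/-- A real symmetric matrix whose eigenvalues are all at least `l ≥ 0` satisfies
`l * ⟨v, A v⟩ ≤ ‖A v‖²`. -/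
theorem mul_dotProduct_mulVec_le {n : Type*} [Fintype n] [DecidableEq n]
    {A : Matrix n n ℝ} (hA : A.IsHermitian) {l : ℝ} (hl : 0 ≤ l)
    (h : ∀ i, l ≤ hA.eigenvalues i) (v : n → ℝ) :
    l * (v ⬝ᵥ A *ᵥ v) ≤ (A *ᵥ v) ⬝ᵥ (A *ᵥ v) := by
  have parseval : ∀ x y : n → ℝ, x ⬝ᵥ y =
      ∑ i, (x ⬝ᵥ (hA.eigenvectorBasis i).ofLp) * (y ⬝ᵥ (hA.eigenvectorBasis i).ofLp) := by
    intro x y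
    have := hA.eigenvectorBasis.sum_inner_mul_inner (WithLp.toLp 2 y) (WithLp.toLp 2 x)
    simp only [EuclideanSpace.inner_eq_star_dotProduct, star_trivial] at this
    rw [← this]
    refine Finset.sum_congr rfl fun i _ => ?_
    rw [dotProduct_comm (hA.eigenvectorBasis i).ofLp, mul_comm]
  have coord : ∀ i, (A *ᵥ v) ⬝ᵥ (hA.eigenvectorBasis i).ofLp =
      hA.eigenvalues i * (v ⬝ᵥ (hA.eigenvectorBasis i).ofLp) := by
    intro i
    have hT : Aᵀ = A := by simpa using hA.eq
    rw [← vecMul_transpose, hT, ← dotProduct_mulVec, hA.mulVec_eigenvectorBasis,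
      dotProduct_smul, smul_eq_mul]
  rw [parseval v, parseval (A *ᵥ v), Finset.mul_sum]
  refine Finset.sum_le_sum fun i _ => ?_
  rw [coord]
  have := mul_le_mul_of_nonneg_right (h i)
    (mul_nonneg (hl.trans (h i)) (sq_nonneg (v ⬝ᵥ (hA.eigenvectorBasis i).ofLp)))
  linarith

/-- Rodrigues' formula: a rotation is recovered from the axial vector of its skew part. -/
theorem SO3.trace_smul_eq {R : Matrix (Fin 3) (Fin 3) ℝ} (hR : SO3 R) :
    (1 + R.trace) • R = (1 + R.trace) • (1 + skew (vex (Pa R))) +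
      (2 : ℝ) • (skew (vex (Pa R)) * skew (vex (Pa R))) := by
  obtain ⟨h1, h2, h3⟩ := hR
  have hadj : R.adjugate = Rᵀ := by
    calc R.adjugate = R.adjugate * (R * Rᵀ) := by rw [h1, mul_one]
      _ = Rᵀ := by rw [← mul_assoc, adjugate_mul, h3, one_smul, one_mul]
  have e1 := fun i j => congrFun (congrFun h1 i) j
  have e2 := fun i j => congrFun (congrFun h2 i) j
  have e3 := fun i j => congrFun (congrFun hadj i) j
  rw [adjugate_fin_three] at e3
  simp only [Matrix.mul_apply, Fin.sum_univ_three, transpose_apply] at e1 e2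
  have a00 := e1 0 0
  have a01 := e1 0 1
  have a02 := e1 0 2
  have a11 := e1 1 1
  have a12 := e1 1 2
  have a22 := e1 2 2
  have b00 := e2 0 0
  have b01 := e2 0 1
  have b02 := e2 0 2
  have b11 := e2 1 1
  have b12 := e2 1 2
  have b22 := e2 2 2
  have c00 := e3 0 0
  have c01 := e3 0 1
  have c02 := e3 0 2
  have c10 := e3 1 0
  have c11 := e3 1 1
  have c12 := e3 1 2
  have c20 := e3 2 0
  have c21 := e3 2 1
  have c22 := e3 2 2
  clear e1 e2 e3
  simp at a00 a01 a02 a11 a12 a22 b00 b01 b02 b11 b12 b22 c00 c01 c02 c10 c11 c12 c20 c21 c22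
  ext i j
  fin_cases i <;> fin_cases j <;>
    simp [skew, vex, Pa, trace_fin_three] <;>
    linarith

/-- For `R ∈ SO(3)` and a symmetric positive-definite `M` with
`Tr M = 3`, letting `λ̲ > 0` be the minimum eigenvalue of `M̆ = Tr(M)·I₃ − M`,
if `1 + Tr R > 0` then `‖RM‖_I ≤ (2/λ̲)·‖vex(P_a(RM))‖²/(1 + Tr R)`. -/
theorem stmt0 (R M : Matrix (Fin 3) (Fin 3) ℝ)
    (hR : SO3 R) (hMsymm : M.IsSymm) (hMpd : M.PosDef)
    (htrM : Matrix.trace M = 3)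
    (hMb : (Matrix.trace M • (1 : Matrix (Fin 3) (Fin 3) ℝ) - M).IsHermitian)
    (lam : ℝ) (hlam : lam = ⨅ i, hMb.eigenvalues i) (hlampos : 0 < lam)
    (htrR : 0 < 1 + Matrix.trace R) :
    normI (R * M) ≤
      (2 / lam) * (∑ i, (vex (Pa (R * M)) i) ^ 2) / (1 + Matrix.trace R) := by
  have key := mul_dotProduct_mulVec_le hMb hlampos.le
    (fun i => hlam ▸ ciInf_le (Set.finite_range _).bddBelow i) (vex (Pa R))
  have hrod := hR.trace_smul_eq
  set t := 1 + R.trace with ht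
  set a := vex (Pa R)
  clear_value a
  set y := (M.trace • (1 : Matrix (Fin 3) (Fin 3) ℝ) - M) *ᵥ a with hy
  have hR' : R = 1 + skew a + (2 / t) • (skew a * skew a) := by
    have : R = t⁻¹ • (t • R) := by rw [smul_smul, inv_mul_cancel₀ htrR.ne', one_smul]
    rw [this, hrod, smul_add, smul_smul, smul_smul, inv_mul_cancel₀ htrR.ne', one_smul,
      div_eq_inv_mul]
  have m01 : M 1 0 = M 0 1 := hMsymm.apply 0 1
  have m02 : M 2 0 = M 0 2 := hMsymm.apply 0 2
  have m12 : M 2 1 = M 1 2 := hMsymm.apply 1 2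
  have hnorm : normI (R * M) = (a ⬝ᵥ y) / (2 * t) := by
    rw [hR', normI, hy]
    simp [skew, trace_fin_three, Matrix.mul_apply, Fin.sum_univ_three, dotProduct, mulVec,
      Matrix.one_apply] at htrM ⊢
    field_simp
    rw [m01, m02, m12]
    linear_combination -2 * t * htrM
  have hpsi : vex (Pa (R * M)) = (1 / 2 : ℝ) • y + t⁻¹ • (crossProduct a y) := by
    rw [hR', hy]
    ext i
    fin_cases i <;>
      simp [skew, vex, Pa, trace_fin_three, Matrix.mul_apply, Fin.sum_univ_three, dotProduct,
        mulVec, Matrix.one_apply, crossProduct] <;>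
      rw [m01, m02, m12] <;> field_simp <;> ring
  have hsq : (y ⬝ᵥ y) / 4 ≤ ∑ i, (vex (Pa (R * M)) i) ^ 2 := by
    rw [hpsi]
    clear_value y
    simp [crossProduct, Fin.sum_univ_three, dotProduct]
    nlinarith [sq_nonneg (t⁻¹ * (a 1 * y 2 - a 2 * y 1)),
      sq_nonneg (t⁻¹ * (a 2 * y 0 - a 0 * y 2)), sq_nonneg (t⁻¹ * (a 0 * y 1 - a 1 * y 0))]
  rw [hnorm, div_mul_eq_mul_div, div_div, div_le_div_iff₀ (by positivity) (by positivity)]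
  have : lam * t * (a ⬝ᵥ y) ≤ t * (4 * ∑ i, (vex (Pa (R * M)) i) ^ 2) := by
    rw [mul_comm lam, mul_assoc]
    exact mul_le_mul_of_nonneg_left (by linarith) htrR.le
  linarith
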